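/- Terminating A_n q-binomial theorem (rectangular sum, version 2): Let n be a positive integer, N_1, …, N_n nonnegative integers, q a nonzero complex number that is not a root of unity, z a complex number, and x_1, …, x_n nonzero complex numbers such that x_i/x_j is not an integer power of q for i ≠ j. Then ∏_{i=1}^n (z·x_i; q)_{N_i} = ∑_{k_1=0}^{N_1} ⋯ ∑_{k_n=0}^{N_n} [ ∏_{i,j=1}^n (q·x_i/x_j; q)_{N_i} / [ (q·x_i/x_j; q)_{k_i} · (q^{1+k_i−k_j}·x_i/x_j; q)_{N_i−k_i} ] · (−1)^{|k|}·q^{∑_{i=1}^n k_i(k_i−1)/2}·z^{|k|} · ∏_{i=1}^n x_i^{k_i} ], where |k| = k_1 + ⋯ + k_n. -/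

import Mathlib

open Finset

/-- The q-shifted factorial `(a;q)_k`. -/
noncomputable def qPoch (q a : ℂ) (k : ℕ) : ℂ := ∏ i ∈ Finset.range k, (1 - a * q ^ i)

/-- The `(i, j)` factor of the summand in the `A_n` q-binomial theorem. -/
noncomputable def pairFactor (q : ℂ) (N k l : ℕ) (x y : ℂ) : ℂ :=
  qPoch q (q * x / y) N /
    (qPoch q (q * x / y) k * qPoch q (q ^ (1 + (k : ℤ) - (l : ℤ)) * x / y) (N - k))

lemma qPoch_succ_right (q a : ℂ) (k : ℕ) :
    qPoch q a (k + 1) = qPoch q a k * (1 - a * q ^ k) := by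
  simp [qPoch, Finset.prod_range_succ]

lemma qPoch_succ_left (q a : ℂ) (k : ℕ) :
    qPoch q a (k + 1) = (1 - a) * qPoch q (q * a) k := by
  simp only [qPoch, Finset.prod_range_succ', pow_zero, mul_one]
  rw [mul_comm]
  congr 1
  exact Finset.prod_congr rfl fun i _ => by ring

lemma qPoch_ne_zero {q a : ℂ} {k : ℕ} (h : ∀ i : ℕ, a * q ^ i ≠ 1) : qPoch q a k ≠ 0 :=
  Finset.prod_ne_zero_iff.2 fun i _ => sub_ne_zero.2 (h i).symm

lemma one_sub_mul_qPoch (q a : ℂ) (k : ℕ) :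
    (1 - a) * qPoch q (q * a) k = (1 - a * q ^ k) * qPoch q a k := by
  rw [← qPoch_succ_left, qPoch_succ_right, mul_comm]

lemma one_sub_mul_pairFactor_self {q : ℂ} (hq : q ≠ 0) (hqru : ∀ m : ℕ, 0 < m → q ^ m ≠ 1)
    (N k : ℕ) {x : ℂ} (hx : x ≠ 0) :
    (1 - q ^ (N + 1)) * pairFactor q N k k (q * x) (q * x) =
      (1 - q ^ (k + 1)) * pairFactor q (N + 1) (k + 1) (k + 1) x x := by
  have e1 : q * (q * x) / (q * x) = q := by field_simp
  have e2 : q * x / x = q := by field_simp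
  have e3 : ∀ m : ℕ, q ^ (1 + (m : ℤ) - (m : ℤ)) = q := fun m => by simp
  have h0 : qPoch q q k ≠ 0 := qPoch_ne_zero fun i => by
    rw [← pow_succ']; exact hqru _ i.succ_pos
  have h1 : (1 - q ^ (k + 1)) ≠ 0 := sub_ne_zero.2 (hqru _ k.succ_pos).symm
  simp only [pairFactor, e1, e2, e3, Nat.add_sub_add_right, qPoch_succ_right, ← pow_succ']
  rw [← mul_div_assoc, ← mul_div_assoc, mul_right_comm (qPoch q q k), mul_comm _ (1 - q ^ (k + 1)),
    mul_div_mul_left _ _ h1, mul_comm]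

lemma pairFactor_mul_left {q : ℂ} (hq : q ≠ 0) (N k l : ℕ) {x y : ℂ}
    (hxy : ∀ m : ℤ, x / y ≠ q ^ m) :
    pairFactor q N k l (q * x) y = pairFactor q (N + 1) (k + 1) l x y := by
  have h : 1 - q * x / y ≠ 0 := fun h => hxy (-1) <| by
    rw [zpow_neg_one]; exact eq_inv_of_mul_eq_one_left (by linear_combination -h)
  have e : q ^ (1 + (k : ℤ) - (l : ℤ)) * (q * x) / y =
      q ^ (1 + ((k + 1 : ℕ) : ℤ) - (l : ℤ)) * x / y := by
    rw [show (1 + ((k + 1 : ℕ) : ℤ) - (l : ℤ)) = (1 + (k : ℤ) - (l : ℤ)) + 1 by push_cast; ring,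
      zpow_add_one₀ hq]
    ring
  simp only [pairFactor, e, Nat.add_sub_add_right, qPoch_succ_left, ← mul_div_assoc]
  rw [mul_assoc, mul_div_mul_left _ _ h]

lemma pairFactor_mul_right {q : ℂ} (hq : q ≠ 0) (N k l : ℕ) {x y : ℂ}
    (hxy : ∀ m : ℤ, x / y ≠ q ^ m) :
    (1 - x / y * q ^ N) * pairFactor q N k l x (q * y) =
      (1 - x / y * q ^ k) * pairFactor q N k (l + 1) x y := by
  have e1 : q * x / (q * y) = x / y := mul_div_mul_left _ _ hq
  have e2 : q ^ (1 + (k : ℤ) - (l : ℤ)) * x / (q * y) =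
      q ^ (1 + (k : ℤ) - ((l + 1 : ℕ) : ℤ)) * x / y := by
    rw [show (1 + (k : ℤ) - (l : ℤ)) = (1 + (k : ℤ) - ((l + 1 : ℕ) : ℤ)) + 1 by push_cast; ring,
      zpow_add_one₀ hq, mul_right_comm, mul_comm _ q, mul_div_mul_left _ _ hq]
  have hne : ∀ j : ℤ, ∀ i : ℕ, q ^ j * (x / y) * q ^ i ≠ 1 := fun j i h => hxy (-(j + i)) <| by
    rw [zpow_neg, zpow_add₀ hq, zpow_natCast]
    exact eq_inv_of_mul_eq_one_left (by linear_combination h)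
  have h0 : qPoch q (x / y) k ≠ 0 := qPoch_ne_zero fun i => by simpa using hne 0 i
  have h1 : qPoch q (q * (x / y)) k ≠ 0 := qPoch_ne_zero fun i => by simpa using hne 1 i
  have hs : 1 - x / y ≠ 0 := sub_ne_zero.2 fun h => hxy 0 (by simpa using h.symm)
  simp only [pairFactor, e1, e2, mul_div_assoc q x y]
  generalize qPoch q _ (N - k) = A
  have hN := one_sub_mul_qPoch q (x / y) N
  have hk := one_sub_mul_qPoch q (x / y) k
  rcases eq_or_ne A 0 with rfl | hA
  · simp
  rw [← mul_div_assoc, ← mul_div_assoc, div_eq_div_iff (mul_ne_zero h0 hA) (mul_ne_zero h1 hA)]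
  linear_combination A * qPoch q (q * (x / y)) N * hk - A * qPoch q (q * (x / y)) k * hN

section PartialFractions

variable {ι : Type*} [Fintype ι] [DecidableEq ι]

open Polynomial in
lemma prod_sub_mul_eq_add_sum (x u : ι → ℂ) (hx : Function.Injective x) (t : ℂ) :
    ∏ b, (t - x b * u b) = ∏ b, (t - x b) + ∑ a, x a * (1 - u a) *
      ∏ b ∈ univ.erase a, ((x a - x b * u b) / (x a - x b) * (t - x b)) := by
  set p : ℂ[X] := ∏ b, (X - C (x b * u b)) with hp
  set r : ℂ[X] := ∏ b, (X - C (x b)) with hr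
  have hpd : p.degree = (univ : Finset ι).card := by rw [hp, degree_prod, Finset.sum_congr rfl fun b _ => degree_X_sub_C _]; simp
  have hrd : r.degree = (univ : Finset ι).card := by simp [hr, degree_prod]
  have hpm : p.Monic := monic_prod_of_monic _ _ fun b _ => monic_X_sub_C _
  have hrm : r.Monic := monic_prod_of_monic _ _ fun b _ => monic_X_sub_C _
  have hd : (p - r).degree < (univ : Finset ι).card := by
    rw [← hpd]
    exact degree_sub_lt_left (hpd.trans hrd.symm) hpm.ne_zero (hpm.leadingCoeff.trans
      hrm.leadingCoeff.symm)
  have h := congrArg (eval t)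
    (Lagrange.eq_interpolate (s := univ) (v := x) (f := p - r) hx.injOn hd)
  have hev : ∀ s, eval s p = ∏ b, (s - x b * u b) := fun s => by simp [hp, eval_prod]
  have hevr : ∀ s, eval s r = ∏ b, (s - x b) := fun s => by simp [hr, eval_prod]
  rw [eval_sub, hev, hevr, sub_eq_iff_eq_add'] at h
  rw [h, Lagrange.interpolate_apply, eval_finsetSum]
  congr 1
  refine Finset.sum_congr rfl fun a _ => ?_
  have h0 : ∏ b, (x a - x b) = 0 := Finset.prod_eq_zero (Finset.mem_univ a) (sub_self _)
  rw [eval_mul, eval_C, eval_sub, hev, hevr, h0, sub_zero, Lagrange.basis, eval_prod,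
    ← Finset.mul_prod_erase _ _ (Finset.mem_univ a), mul_assoc, ← Finset.prod_mul_distrib,
    show x a - x a * u a = x a * (1 - u a) by ring]
  congr 1
  refine Finset.prod_congr rfl fun b _ => ?_
  simp only [Lagrange.basisDivisor, eval_mul, eval_C, eval_sub, eval_X]
  ring

lemma one_sub_prod_eq_sum (x u : ι → ℂ) (hx : Function.Injective x) (h0 : ∀ i, x i ≠ 0) :
    1 - ∏ b, u b = ∑ a, (1 - u a) *
      ∏ b ∈ univ.erase a, ((x a - x b * u b) / (x a - x b)) := by
  have h := prod_sub_mul_eq_add_sum x u hx 0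
  have hP : ∏ b, (0 - x b) ≠ 0 := Finset.prod_ne_zero_iff.2 fun b _ => by simpa using h0 b
  have h1 : ∏ b, (0 - x b * u b) = (∏ b, (0 - x b)) * ∏ b, u b := by
    rw [← Finset.prod_mul_distrib]
    exact Finset.prod_congr rfl fun b _ => by ring
  have h2 : ∀ a, x a * (1 - u a) *
      ∏ b ∈ univ.erase a, ((x a - x b * u b) / (x a - x b) * (0 - x b)) =
      -(∏ b, (0 - x b)) * ((1 - u a) *
        ∏ b ∈ univ.erase a, ((x a - x b * u b) / (x a - x b))) := fun a => by
    rw [Finset.prod_mul_distrib, ← Finset.mul_prod_erase _ _ (Finset.mem_univ a)]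
    ring
  simp only [h1, h2, ← Finset.mul_sum] at h
  apply mul_left_cancel₀ hP
  linear_combination -h

lemma prod_one_sub_mul_eq_add_sum (x u : ι → ℂ) (hx : Function.Injective x) (z : ℂ) :
    ∏ b, (1 - z * x b * u b) = ∏ b, (1 - z * x b) + z * ∑ a, x a * (1 - u a) *
      ∏ b ∈ univ.erase a, ((x a - x b * u b) / (x a - x b) * (1 - z * x b)) := by
  rcases eq_or_ne z 0 with rfl | hz
  · simp
  have h := congrArg (z ^ (univ : Finset ι).card * ·) (prod_sub_mul_eq_add_sum x u hx z⁻¹)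
  simp only [mul_add, Finset.mul_sum] at h ⊢
  have h1 : ∀ (s : Finset ι) (f : ι → ℂ), z ^ s.card * ∏ b ∈ s, f b = ∏ b ∈ s, (z * f b) :=
    fun s f => by rw [Finset.prod_mul_distrib, Finset.prod_const]
  rw [h1, h1] at h
  have h2 : ∀ y, z * (z⁻¹ - y) = 1 - z * y := fun y => by field_simp
  simp only [h2, ← mul_assoc] at h
  simp only [← mul_assoc]
  rw [h]
  congr 1
  refine Finset.sum_congr rfl fun a _ => ?_
  rw [← Finset.card_erase_add_one (Finset.mem_univ a), pow_succ]
  have h3 := h1 (univ.erase a) fun b => (x a - x b * u b) / (x a - x b) * (z⁻¹ - x b)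
  have h4 : ∀ b, z * ((x a - x b * u b) / (x a - x b) * (z⁻¹ - x b)) =
      (x a - x b * u b) / (x a - x b) * (1 - z * x b) := fun b => by rw [← h2]; ring
  simp only [h4] at h3
  rw [← h3]
  ring

end PartialFractions

section Summand

variable {ι : Type*} [Fintype ι] [DecidableEq ι]

/-- The coefficient of `z ^ |k|` in the summand indexed by `k`. -/
noncomputable def binomCoeff (q : ℂ) (N k : ι → ℕ) (x : ι → ℂ) : ℂ :=
  (∏ i, ∏ j, pairFactor q (N i) (k i) (k j) (x i) (x j)) *
    (-1) ^ (∑ i, k i) * q ^ (∑ i, Nat.choose (k i) 2) * ∏ i, x i ^ (k i)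

/-- The coefficient of the shift in direction `a` in the q-difference equation. -/
noncomputable def shiftCoeff (q : ℂ) (N : ι → ℕ) (x : ι → ℂ) (a : ι) : ℂ :=
  x a * (1 - q ^ N a) * ∏ b ∈ univ.erase a, ((x a - x b * q ^ N b) / (x a - x b))

lemma prod_prod_eq_split (f : ι → ι → ℂ) (a : ι) :
    ∏ i, ∏ j, f i j = f a a * (∏ j ∈ univ.erase a, f a j) * (∏ i ∈ univ.erase a, f i a) *
      ∏ i ∈ univ.erase a, ∏ j ∈ univ.erase a, f i j := by
  have h : ∀ i, ∏ j, f i j = f i a * ∏ j ∈ univ.erase a, f i j := fun i =>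
    (Finset.mul_prod_erase _ _ (Finset.mem_univ a)).symm
  rw [← Finset.mul_prod_erase _ _ (Finset.mem_univ a), h a]
  simp only [h, Finset.prod_mul_distrib]
  ring

variable {q : ℂ} (hq : q ≠ 0) (hqru : ∀ m : ℕ, 0 < m → q ^ m ≠ 1)

include hq hqru in
lemma shift_mul_prod_pairFactor (N k : ι → ℕ) {x : ι → ℂ} (hx : ∀ i, x i ≠ 0)
    (hxq : ∀ i j, i ≠ j → ∀ m : ℤ, x i / x j ≠ q ^ m) (a : ι) :
    shiftCoeff q (N + Pi.single a 1) x a *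
      (∏ i, ∏ j, pairFactor q (N i) (k i) (k j) (Function.update x a (q * x a) i)
        (Function.update x a (q * x a) j)) =
    x a * ((1 - q ^ (k a + 1)) *
      ∏ b ∈ univ.erase a, ((x a - x b * q ^ k b) / (x a - x b))) *
      ∏ i, ∏ j, pairFactor q ((N + Pi.single a 1 : ι → ℕ) i) ((k + Pi.single a 1 : ι → ℕ) i)
        ((k + Pi.single a 1 : ι → ℕ) j) (x i) (x j) := by
  have hs : ∀ (f : ι → ℕ) b, b ∈ univ.erase a → (f + Pi.single a 1 : ι → ℕ) b = f b := fun f b hb => by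
    simp [Pi.single_eq_of_ne (Finset.ne_of_mem_erase hb)]
  have hsa : ∀ (f : ι → ℕ), (f + Pi.single a 1 : ι → ℕ) a = f a + 1 := fun f => by simp
  have hu : ∀ b, b ∈ univ.erase a → Function.update x a (q * x a) b = x b := fun b hb =>
    Function.update_of_ne (Finset.ne_of_mem_erase hb) _ _
  have hne : ∀ b, b ∈ univ.erase a → x a - x b ≠ 0 := fun b hb h => by
    refine hxq a b (Finset.ne_of_mem_erase hb).symm 0 ?_
    rw [sub_eq_zero.1 h, div_self (hx b), zpow_zero]
  rw [prod_prod_eq_split _ a, prod_prod_eq_split _ a, shiftCoeff]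
  have e1 : ∏ j ∈ univ.erase a, pairFactor q (N a) (k a) (k j)
        (Function.update x a (q * x a) a) (Function.update x a (q * x a) j) =
      ∏ j ∈ univ.erase a, pairFactor q ((N + Pi.single a 1 : ι → ℕ) a) ((k + Pi.single a 1 : ι → ℕ) a)
        ((k + Pi.single a 1 : ι → ℕ) j) (x a) (x j) := by
    refine Finset.prod_congr rfl fun b hb => ?_
    rw [hu b hb, hsa, hsa, hs k b hb, Function.update_self]
    exact pairFactor_mul_left hq _ _ _ (hxq a b (Finset.ne_of_mem_erase hb).symm)
  have e2 : (∏ b ∈ univ.erase a, ((x a - x b * q ^ (N + Pi.single a 1 : ι → ℕ) b) / (x a - x b))) *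
        (∏ b ∈ univ.erase a, pairFactor q (N b) (k b) (k a)
        (Function.update x a (q * x a) b) (Function.update x a (q * x a) a)) =
      (∏ b ∈ univ.erase a, ((x a - x b * q ^ k b) / (x a - x b))) *
      ∏ b ∈ univ.erase a, pairFactor q ((N + Pi.single a 1 : ι → ℕ) b) ((k + Pi.single a 1 : ι → ℕ) b)
        ((k + Pi.single a 1 : ι → ℕ) a) (x b) (x a) := by
    rw [← Finset.prod_mul_distrib, ← Finset.prod_mul_distrib]
    refine Finset.prod_congr rfl fun b hb => ?_
    rw [hu b hb, hsa, hs k b hb, hs N b hb, Function.update_self]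
    have h := pairFactor_mul_right hq (N b) (k b) (k a) (hxq b a (Finset.ne_of_mem_erase hb))
    have h1 : ∀ m : ℕ, (x a - x b * q ^ m) / (x a - x b) =
        x a / (x a - x b) * (1 - x b / x a * q ^ m) := fun m => by
      have := hx a
      have := hne b hb
      field_simp
    rw [h1, h1, mul_assoc, h, mul_assoc]
  have e3 : ∏ i ∈ univ.erase a, ∏ j ∈ univ.erase a, pairFactor q (N i) (k i) (k j)
        (Function.update x a (q * x a) i) (Function.update x a (q * x a) j) =
      ∏ i ∈ univ.erase a, ∏ j ∈ univ.erase a, pairFactor q ((N + Pi.single a 1 : ι → ℕ) i)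
        ((k + Pi.single a 1 : ι → ℕ) i) ((k + Pi.single a 1 : ι → ℕ) j) (x i) (x j) :=
    Finset.prod_congr rfl fun b hb => Finset.prod_congr rfl fun c hc => by
      rw [hu b hb, hu c hc, hs k b hb, hs k c hc, hs N b hb]
  have e0 : (1 - q ^ (N + Pi.single a 1 : ι → ℕ) a) * pairFactor q (N a) (k a) (k a)
        (Function.update x a (q * x a) a) (Function.update x a (q * x a) a) =
      (1 - q ^ (k a + 1)) * pairFactor q ((N + Pi.single a 1 : ι → ℕ) a)
        ((k + Pi.single a 1 : ι → ℕ) a) ((k + Pi.single a 1 : ι → ℕ) a) (x a) (x a) := by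
    rw [hsa, hsa, Function.update_self]
    exact one_sub_mul_pairFactor_self hq hqru (N a) (k a) (hx a)
  rw [e1, e3]
  generalize ∏ i ∈ univ.erase a, ∏ j ∈ univ.erase a, pairFactor q _ _ _ _ _ = Z
  generalize ∏ j ∈ univ.erase a, pairFactor q _ _ _ (x a) (x j) = A
  generalize pairFactor q _ _ _ (x a) (x a) = G at *
  generalize pairFactor q _ _ _ (Function.update x a (q * x a) a) _ = F at *
  generalize ∏ b ∈ univ.erase a, pairFactor q _ _ _ (x b) (x a) = B' at *
  linear_combination (x a * (1 - q ^ (N + Pi.single a 1 : ι → ℕ) a) * F * A * Z) * e2 +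
    x a * A * Z * (∏ b ∈ univ.erase a, ((x a - x b * q ^ k b) / (x a - x b))) * B' * e0

include hq hqru in
lemma shiftCoeff_mul_binomCoeff (N k : ι → ℕ) {x : ι → ℂ} (hx : ∀ i, x i ≠ 0)
    (hxq : ∀ i j, i ≠ j → ∀ m : ℤ, x i / x j ≠ q ^ m) (a : ι) :
    shiftCoeff q (N + Pi.single a 1) x a *
      binomCoeff q N k (Function.update x a (q * x a)) =
    -((1 - q ^ (k a + 1)) *
      ∏ b ∈ univ.erase a, ((x a - x b * q ^ k b) / (x a - x b))) *
      binomCoeff q (N + Pi.single a 1) (k + Pi.single a 1) x := by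
  have h := shift_mul_prod_pairFactor hq hqru N k hx hxq a
  have h1 : ∑ i, (k + Pi.single a 1 : ι → ℕ) i = ∑ i, k i + 1 := by
    simp [Finset.sum_add_distrib]
  have h2 : ∑ i, Nat.choose ((k + Pi.single a 1 : ι → ℕ) i) 2 = ∑ i, Nat.choose (k i) 2 + k a := by
    rw [← Finset.add_sum_erase _ _ (Finset.mem_univ a),
      ← Finset.add_sum_erase univ (fun i => Nat.choose (k i) 2) (Finset.mem_univ a),
      Finset.sum_congr rfl fun b hb => by
        rw [Pi.add_apply, Pi.single_eq_of_ne (Finset.ne_of_mem_erase hb), add_zero]]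
    simp [Nat.choose_succ_succ' (k a) 1]
    ring
  have h3 : x a * ∏ i, Function.update x a (q * x a) i ^ k i =
      q ^ k a * ∏ i, x i ^ ((k + Pi.single a 1 : ι → ℕ) i) := by
    have h4 : ∏ b ∈ univ.erase a, x b ^ (k + Pi.single a 1 : ι → ℕ) b =
        ∏ b ∈ univ.erase a, Function.update x a (q * x a) b ^ k b :=
      Finset.prod_congr rfl fun b hb => by
        rw [Pi.add_apply, Pi.single_eq_of_ne (Finset.ne_of_mem_erase hb), add_zero,
          Function.update_of_ne (Finset.ne_of_mem_erase hb)]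
    have h5 : ∏ b, x b ^ (k + Pi.single a 1 : ι → ℕ) b = x a ^ (k + Pi.single a 1 : ι → ℕ) a *
        ∏ b ∈ univ.erase a, x b ^ (k + Pi.single a 1 : ι → ℕ) b :=
      (Finset.mul_prod_erase _ _ (Finset.mem_univ a)).symm
    rw [← Finset.mul_prod_erase _ _ (Finset.mem_univ a), h5, h4]
    simp only [Function.update_self, Pi.add_apply, Pi.single_eq_same]
    ring
  have hx0 := hx a
  simp only [binomCoeff, h1, h2, pow_succ, pow_add]
  apply mul_left_cancel₀ hx0
  linear_combination
    (-1) ^ (∑ i, k i) * q ^ (∑ i, Nat.choose (k i) 2) *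
      (x a * ∏ i, Function.update x a (q * x a) i ^ k i) * h +
    x a * (1 - q ^ k a * q) * (∏ b ∈ univ.erase a, ((x a - x b * q ^ k b) / (x a - x b))) *
      (∏ i, ∏ j, pairFactor q ((N + Pi.single a 1 : ι → ℕ) i) ((k + Pi.single a 1 : ι → ℕ) i)
        ((k + Pi.single a 1 : ι → ℕ) j) (x i) (x j)) *
      (-1) ^ (∑ i, k i) * q ^ (∑ i, Nat.choose (k i) 2) * h3

/-- The sum side of the `A_n` q-binomial theorem. -/
noncomputable def binomSum (q : ℂ) (N : ι → ℕ) (x : ι → ℂ) (z : ℂ) : ℂ :=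
  ∑ k ∈ Fintype.piFinset (fun i => Finset.range (N i + 1)),
    binomCoeff q N k x * z ^ (∑ i, k i)

omit [Fintype ι] [DecidableEq ι] in
lemma injective_of_div_ne_zpow {x : ι → ℂ} (hx : ∀ i, x i ≠ 0)
    (hxq : ∀ i j, i ≠ j → ∀ m : ℤ, x i / x j ≠ q ^ m) : Function.Injective x := fun i j h => by
  by_contra hij
  exact hxq i j hij 0 (by rw [h, div_self (hx j), zpow_zero])

include hq hqru in
lemma binomSum_sub_binomSum_mul (N : ι → ℕ) {x : ι → ℂ} (hx : ∀ i, x i ≠ 0)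
    (hxq : ∀ i j, i ≠ j → ∀ m : ℤ, x i / x j ≠ q ^ m) (z : ℂ) :
    binomSum q N x z - binomSum q N x (q * z) =
      -z * ∑ a, shiftCoeff q N x a *
        binomSum q (N - Pi.single a 1) (Function.update x a (q * x a)) z := by
  have hinj := injective_of_div_ne_zpow hx hxq
  set R : (ι → ℕ) → ι → ℂ := fun k a =>
    ∏ b ∈ univ.erase a, ((x a - x b * q ^ k b) / (x a - x b)) with hR
  have h1 : binomSum q N x z - binomSum q N x (q * z) =
      ∑ k ∈ Fintype.piFinset (fun i => Finset.range (N i + 1)), ∑ a,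
        (1 - q ^ k a) * R k a * binomCoeff q N k x * z ^ (∑ i, k i) := by
    rw [binomSum, binomSum, ← Finset.sum_sub_distrib]
    refine Finset.sum_congr rfl fun k _ => ?_
    have h := one_sub_prod_eq_sum x (fun b => q ^ k b) hinj hx
    rw [Finset.prod_pow_eq_pow_sum] at h
    simp only [mul_assoc _ (binomCoeff q N k x)]
    rw [← Finset.sum_mul, ← h]
    ring
  rw [h1, Finset.sum_comm, Finset.mul_sum]
  refine Finset.sum_congr rfl fun a _ => ?_
  rcases Nat.eq_zero_or_pos (N a) with h0 | h0
  · rw [shiftCoeff, h0, pow_zero, sub_self, mul_zero, zero_mul, zero_mul, mul_zero]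
    refine Finset.sum_eq_zero fun k hk => ?_
    have : k a = 0 := by
      have := Finset.mem_range.1 (Fintype.mem_piFinset.1 hk a)
      omega
    simp [this]
  obtain ⟨M, rfl⟩ : ∃ M : ι → ℕ, N = M + Pi.single a 1 := by
    refine ⟨N - Pi.single a 1, (tsub_add_cancel_of_le fun b => ?_).symm⟩
    rcases eq_or_ne b a with rfl | hb
    · simpa using Nat.one_le_iff_ne_zero.2 h0.ne'
    · simp [Pi.single_eq_of_ne hb]
  rw [add_tsub_cancel_right, binomSum, Finset.mul_sum, Finset.mul_sum]
  symm
  refine Finset.sum_of_injOn (fun k => k + Pi.single a 1) (fun k _ l _ h => add_right_cancel h)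
    (fun k hk => ?_) (fun k hk hk' => ?_) (fun k _ => ?_)
  · rw [Finset.mem_coe, Fintype.mem_piFinset] at hk ⊢
    intro b
    have := Finset.mem_range.1 (hk b)
    simp only [Pi.add_apply, Finset.mem_range]
    omega
  · have hka : k a = 0 := by
      by_contra hka
      refine hk' ⟨k - Pi.single a 1, ?_, tsub_add_cancel_of_le fun b => ?_⟩
      · rw [Fintype.mem_piFinset] at hk
        rw [Finset.mem_coe, Fintype.mem_piFinset]
        intro b
        have := Finset.mem_range.1 (hk b)
        simp only [Pi.add_apply, Pi.sub_apply, Finset.mem_range] at this ⊢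
        rcases eq_or_ne b a with rfl | hb
        · simp only [Pi.single_eq_same] at this ⊢
          omega
        · simpa only [Pi.single_eq_of_ne hb, add_zero, tsub_zero] using this
      · rcases eq_or_ne b a with rfl | hb
        · simpa [Nat.one_le_iff_ne_zero] using hka
        · simp [Pi.single_eq_of_ne hb]
    simp [hka]
  · have h := shiftCoeff_mul_binomCoeff hq hqru M k hx hxq a
    have h2 : ∑ i, (k + Pi.single a 1 : ι → ℕ) i = ∑ i, k i + 1 := by
      simp [Finset.sum_add_distrib]
    have h3 : R (k + Pi.single a 1) a = R k a := Finset.prod_congr rfl fun b hb => by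
      rw [Pi.add_apply, Pi.single_eq_of_ne (Finset.ne_of_mem_erase hb), add_zero]
    have h4 : (k + Pi.single a 1 : ι → ℕ) a = k a + 1 := by simp
    simp only [h2, h3, h4]
    linear_combination -z * z ^ (∑ i, k i) * h

lemma prod_qPoch_sub_prod_qPoch_mul (N : ι → ℕ) {x : ι → ℂ} (hx : Function.Injective x) (z : ℂ)
    (hz : ∀ i, 1 - z * x i ≠ 0) :
    ∏ i, qPoch q (z * x i) (N i) - ∏ i, qPoch q (q * z * x i) (N i) =
      -z * ∑ a, shiftCoeff q N x a * ∏ i, qPoch q (z * Function.update x a (q * x a) i)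
        ((N - Pi.single a 1 : ι → ℕ) i) := by
  have hW : ∏ i, (1 - z * x i) ≠ 0 := Finset.prod_ne_zero_iff.2 fun i _ => hz i
  have h1 : (∏ i, (1 - z * x i)) * ∏ i, qPoch q (q * z * x i) (N i) =
      (∏ i, (1 - z * x i * q ^ N i)) * ∏ i, qPoch q (z * x i) (N i) := by
    simp only [← Finset.prod_mul_distrib, mul_assoc q, one_sub_mul_qPoch]
  have h2 : ∀ a, (∏ i, (1 - z * x i)) * (shiftCoeff q N x a *
      ∏ i, qPoch q (z * Function.update x a (q * x a) i) ((N - Pi.single a 1 : ι → ℕ) i)) =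
      (∏ i, qPoch q (z * x i) (N i)) * (x a * (1 - q ^ N a) *
        ∏ b ∈ univ.erase a, ((x a - x b * q ^ N b) / (x a - x b) * (1 - z * x b))) := fun a => by
    rcases Nat.eq_zero_or_pos (N a) with h0 | h0
    · simp [shiftCoeff, h0]
    obtain ⟨m, hm⟩ := Nat.exists_eq_succ_of_ne_zero h0.ne'
    have h3 : ∏ b ∈ univ.erase a, qPoch q (z * Function.update x a (q * x a) b)
        ((N - Pi.single a 1 : ι → ℕ) b) = ∏ b ∈ univ.erase a, qPoch q (z * x b) (N b) :=
      Finset.prod_congr rfl fun b hb => by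
        rw [Pi.sub_apply, Pi.single_eq_of_ne (Finset.ne_of_mem_erase hb), tsub_zero,
          Function.update_of_ne (Finset.ne_of_mem_erase hb)]
    have h4 : (N - Pi.single a 1 : ι → ℕ) a = m := by simp [hm]
    have h5 := qPoch_succ_left q (z * x a) m
    rw [← Finset.mul_prod_erase univ (fun i => qPoch q (z * Function.update x a (q * x a) i) _)
        (Finset.mem_univ a), h3, h4, Function.update_self,
      ← Finset.mul_prod_erase univ (fun i => qPoch q (z * x i) (N i)) (Finset.mem_univ a),
      ← Finset.mul_prod_erase univ (fun i => 1 - z * x i) (Finset.mem_univ a),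
      Finset.prod_mul_distrib, shiftCoeff, hm, Nat.succ_eq_add_one, h5, mul_left_comm z q]
    ring
  apply mul_left_cancel₀ hW
  have h6 := prod_one_sub_mul_eq_add_sum x (fun b => q ^ N b) hx z
  rw [mul_sub, h1, h6, mul_left_comm _ (-z), Finset.mul_sum univ _ (∏ i, (1 - z * x i)),
    Finset.sum_congr rfl fun a _ => h2 a, ← Finset.mul_sum]
  ring

open Polynomial in
include hqru in
lemma eq_C_of_eval_mul_eq {p : ℂ[X]} {S : Set ℂ} (hS : S.Finite)
    (h : ∀ z ∉ S, p.eval z = p.eval (q * z)) : p = C (p.coeff 0) := by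
  have hp : p = p.comp (C q * X) := by
    refine eq_of_infinite_eval_eq _ _ (hS.infinite_compl.mono fun z hz => ?_)
    simpa using h z hz
  ext m
  rcases Nat.eq_zero_or_pos m with rfl | hm
  · simp
  have hc := congrArg (fun r => coeff r m) hp
  simp only [comp_C_mul_X_coeff] at hc
  rw [coeff_C_of_ne_zero hm.ne']
  have : p.coeff m * (1 - q ^ m) = 0 := by linear_combination hc
  exact (mul_eq_zero.1 this).resolve_right (sub_ne_zero.2 (hqru m hm).symm)

include hqru in
lemma binomSum_zero (N : ι → ℕ) {x : ι → ℂ} (hx : ∀ i, x i ≠ 0)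
    (hxq : ∀ i j, i ≠ j → ∀ m : ℤ, x i / x j ≠ q ^ m) : binomSum q N x 0 = 1 := by
  rw [binomSum, Finset.sum_eq_single 0]
  · have h : ∀ i j, pairFactor q (N i) 0 0 (x i) (x j) = 1 := fun i j => by
      have : qPoch q (q * x i / x j) (N i) ≠ 0 := qPoch_ne_zero fun m hm => by
        rcases eq_or_ne i j with rfl | hij
        · rw [mul_div_assoc, div_self (hx i), mul_one, ← pow_succ'] at hm
          exact hqru _ m.succ_pos hm
        · refine hxq i j hij (-(m + 1 : ℕ)) ?_
          rw [zpow_neg, zpow_natCast]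
          exact eq_inv_of_mul_eq_one_left (by linear_combination hm)
      simp [pairFactor, this, show qPoch q (q * x i / x j) 0 = 1 by simp [qPoch]]
    simp [binomCoeff, h]
  · intro k _ hk
    have : ∑ i, k i ≠ 0 := fun h => hk <| funext fun i =>
      (Finset.sum_eq_zero_iff.1 h) i (Finset.mem_univ i)
    rw [zero_pow this, mul_zero]
  · intro h
    exact absurd (Fintype.mem_piFinset.2 fun i => by simp) h

include hq in
omit [Fintype ι] in
lemma update_mul_div_ne_zpow {x : ι → ℂ}
    (hxq : ∀ i j, i ≠ j → ∀ m : ℤ, x i / x j ≠ q ^ m) (a : ι) (i j : ι) (hij : i ≠ j) (m : ℤ) :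
    Function.update x a (q * x a) i / Function.update x a (q * x a) j ≠ q ^ m := by
  intro h
  rcases eq_or_ne i a with rfl | hi
  · rw [Function.update_self, Function.update_of_ne hij.symm] at h
    refine hxq i j hij (m - 1) ?_
    rw [zpow_sub_one₀ hq, ← h]
    field_simp
  rw [Function.update_of_ne hi] at h
  rcases eq_or_ne j a with rfl | hj
  · rw [Function.update_self] at h
    refine hxq i j hij (m + 1) ?_
    rw [zpow_add_one₀ hq, ← h]
    field_simp
  · rw [Function.update_of_ne hj] at h
    exact hxq i j hij m h

open Polynomial in
include hq hqru in
/-- The `A_n` q-binomial theorem, by induction along the q-difference equation in `z`. -/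
theorem prod_qPoch_eq_binomSum (N : ι → ℕ) {x : ι → ℂ} (hx : ∀ i, x i ≠ 0)
    (hxq : ∀ i j, i ≠ j → ∀ m : ℤ, x i / x j ≠ q ^ m) (z : ℂ) :
    ∏ i, qPoch q (z * x i) (N i) = binomSum q N x z := by
  induction hs : ∑ i, N i using Nat.strong_induction_on generalizing N x z with
  | _ s ih =>
  have hinj := injective_of_div_ne_zpow hx hxq
  set pL : ℂ[X] := ∏ i, ∏ m ∈ Finset.range (N i), (1 - X * C (x i) * C (q ^ m)) with hpL
  set pR : ℂ[X] := ∑ k ∈ Fintype.piFinset (fun i => Finset.range (N i + 1)),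
    C (binomCoeff q N k x) * X ^ (∑ i, k i) with hpR
  have hL : ∀ w, pL.eval w = ∏ i, qPoch q (w * x i) (N i) := fun w => by
    simp [hpL, eval_prod, qPoch, mul_comm w]
  have hR : ∀ w, pR.eval w = binomSum q N x w := fun w => by
    simp [hpR, eval_finsetSum, binomSum]
  have hS : {w : ℂ | ∃ i, w = (x i)⁻¹}.Finite :=
    (Set.finite_range fun i => (x i)⁻¹).subset fun w ⟨i, hi⟩ => ⟨i, hi.symm⟩
  have hp := eq_C_of_eval_mul_eq hqru (p := pL - pR) hS fun w hw => by
    have hw' : ∀ i, 1 - w * x i ≠ 0 := fun i h =>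
      hw ⟨i, eq_inv_of_mul_eq_one_left (sub_eq_zero.1 h).symm⟩
    have h1 := prod_qPoch_sub_prod_qPoch_mul (q := q) N hinj w hw'
    have h2 := binomSum_sub_binomSum_mul hq hqru N hx hxq w
    have h3 : ∀ a, shiftCoeff q N x a * ∏ i, qPoch q (w * Function.update x a (q * x a) i)
        ((N - Pi.single a 1 : ι → ℕ) i) = shiftCoeff q N x a *
        binomSum q (N - Pi.single a 1) (Function.update x a (q * x a)) w := fun a => by
      rcases Nat.eq_zero_or_pos (N a) with h0 | h0
      · simp [shiftCoeff, h0]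
      congr 1
      refine ih _ ?_ _ (fun i => ?_) (update_mul_div_ne_zpow hq hxq a) w rfl
      · rw [← hs]
        refine Finset.sum_lt_sum (fun i _ => by simp) ⟨a, Finset.mem_univ a, ?_⟩
        simpa using h0
      · rcases eq_or_ne i a with rfl | hi
        · simpa using ⟨hq, hx i⟩
        · simpa [Function.update_of_ne hi] using hx i
    rw [Finset.sum_congr rfl fun a _ => h3 a, ← h2] at h1
    rw [eval_sub, eval_sub, hL, hL, hR, hR]
    linear_combination h1
  have h0 : (pL - pR).coeff 0 = 0 := by
    rw [coeff_zero_eq_eval_zero, eval_sub, hL, hR, binomSum_zero hqru N hx hxq]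
    simp [qPoch]
  rw [h0, C_0, sub_eq_zero] at hp
  rw [← hL, ← hR, hp]

end Summand

/-- Terminating `A_n` q-binomial theorem (rectangular sum, version 2). -/
theorem stmt_8 (n : ℕ) (hn : 0 < n) (N : Fin n → ℕ) (q : ℂ) (hq : q ≠ 0)
    (hqru : ∀ m : ℕ, 0 < m → q ^ m ≠ 1) (z : ℂ)
    (x : Fin n → ℂ) (hx : ∀ i, x i ≠ 0)
    (hxq : ∀ i j : Fin n, i ≠ j → ∀ m : ℤ, x i / x j ≠ q ^ m) :
    (∏ i, qPoch q (z * x i) (N i)) =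
      ∑ k ∈ Fintype.piFinset (fun i => Finset.range (N i + 1)),
        ((∏ i, ∏ j, qPoch q (q * x i / x j) (N i) /
            (qPoch q (q * x i / x j) (k i) *
              qPoch q (q ^ (1 + (k i : ℤ) - (k j : ℤ)) * x i / x j) (N i - k i))) *
          (-1) ^ (∑ i, k i) * q ^ (∑ i, Nat.choose (k i) 2) * z ^ (∑ i, k i) *
          ∏ i, x i ^ (k i)) := by
  rw [prod_qPoch_eq_binomSum hq hqru N hx hxq z]
  refine Finset.sum_congr rfl fun k _ => ?_
  simp only [binomCoeff, pairFactor]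
  ring
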